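/- arXiv:2204.05037 — 2 statements merged into one kernel-verified Lean document; each statement's English description precedes it below -/
import Mathlib

section
/- Let N = p_1^{r_1} ⋯ p_ℓ^{r_ℓ} be the prime factorization of N, let μ ≥ 1, let f ∈ ℤ[X_1,...,X_μ] be a multilinear polynomial (degree at most 1 in each variable) whose content is coprime to N, and let m > 1. Then for x sampled uniformly from {0,...,m-1}^μ, P[f(x) ≡ 0 (mod N)] ≤ μ/m + Π_{i=1}^ℓ I_{1/p_i}(r_i, μ), where I_{1/p}(r, μ) = (1 - 1/p)^μ Σ_{j≥r} C(μ+j-1, j) p^{-j}. -/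
/-- The regularized incomplete beta function at integer parameters:
`I_ε(r, μ) = (1-ε)^μ · Σ_{j≥r} C(μ+j-1, j) ε^j`. -/
noncomputable def Ireg (ε : ℝ) (r μ : ℕ) : ℝ :=
  (1 - ε) ^ μ * ∑' j : ℕ, if r ≤ j then ((μ + j - 1).choose j : ℝ) * ε ^ j else 0

/-- Upper tail `P(Z ≥ s)` of the sum `Z` of `n` independent geometric variables with ratio `ε`. -/
noncomputable def negBinTail (ε : ℝ) (n s : ℕ) : ℝ :=
  1 - (1 - ε) ^ n * ∑ j ∈ Finset.range s, (n.multichoose j : ℝ) * ε ^ j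

lemma negBinTail_zero_right (ε : ℝ) (n : ℕ) : negBinTail ε n 0 = 1 := by
  simp [negBinTail]

lemma negBinTail_zero_succ (ε : ℝ) (s : ℕ) : negBinTail ε 0 (s + 1) = 0 := by
  simp [negBinTail, Finset.sum_range_succ']

lemma negBinTail_succ_succ (ε : ℝ) (n s : ℕ) :
    negBinTail ε (n + 1) (s + 1) =
      (1 - ε) * negBinTail ε n (s + 1) + ε * negBinTail ε (n + 1) s := by
  have pascal : ∑ j ∈ Finset.range (s + 1), ((n + 1).multichoose j : ℝ) * ε ^ j =
      ∑ j ∈ Finset.range (s + 1), (n.multichoose j : ℝ) * ε ^ j +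
        ε * ∑ j ∈ Finset.range s, ((n + 1).multichoose j : ℝ) * ε ^ j := by
    rw [Finset.sum_range_succ', Finset.sum_range_succ' (fun j => (n.multichoose j : ℝ) * ε ^ j),
      Finset.mul_sum, add_right_comm, ← Finset.sum_add_distrib]
    simp only [Nat.multichoose_succ_succ, Nat.multichoose_zero_right]
    congr 1
    refine Finset.sum_congr rfl fun j _ => ?_
    push_cast
    ring
  unfold negBinTail
  rw [pascal]
  ring

lemma negBinTail_succ_le {ε : ℝ} (h0 : 0 ≤ ε) (h1 : ε ≤ 1) (n s : ℕ) :
    negBinTail ε n (s + 1) ≤ negBinTail ε n s := by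
  have : 0 ≤ 1 - ε := sub_nonneg.2 h1
  have : 0 ≤ (1 - ε) ^ n * ((n.multichoose s : ℝ) * ε ^ s) := by positivity
  unfold negBinTail
  rw [Finset.sum_range_succ]
  linarith

lemma negBinTail_nonneg {ε : ℝ} (h0 : 0 ≤ ε) (h1 : ε ≤ 1) (n s : ℕ) :
    0 ≤ negBinTail ε n s := by
  induction n generalizing s with
  | zero => cases s <;> simp [negBinTail_zero_right, negBinTail_zero_succ]
  | succ n ihn =>
    induction s with
    | zero => simp [negBinTail_zero_right]
    | succ s ihs =>
      rw [negBinTail_succ_succ]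
      have : 0 ≤ 1 - ε := sub_nonneg.2 h1
      have := ihn (s + 1)
      positivity

lemma Ireg_eq_negBinTail {ε : ℝ} (h0 : 0 ≤ ε) (h1 : ε < 1) (r : ℕ) {n : ℕ} (hn : 1 ≤ n) :
    Ireg ε r n = negBinTail ε n r := by
  obtain ⟨k, rfl⟩ := Nat.exists_eq_add_of_le' hn
  have hs : HasSum (fun j : ℕ => ((k + 1).multichoose j : ℝ) * ε ^ j) (1 / (1 - ε) ^ (k + 1)) := by
    have h := hasSum_choose_mul_geometric_of_norm_lt_one (𝕜 := ℝ) k (r := ε)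
      (by rwa [Real.norm_of_nonneg h0])
    have hchoose : ∀ j, (k + 1).multichoose j = (j + k).choose k := fun j => by
      rw [Nat.multichoose_eq, show k + 1 + j - 1 = j + k by omega, Nat.choose_symm_add]
    simpa only [hchoose] using h
  have hne : (1 - ε) ^ (k + 1) ≠ 0 := pow_ne_zero _ (by linarith)
  have hf : HasSum (fun j : ℕ => if j < r then ((k + 1).multichoose j : ℝ) * ε ^ j else 0)
      (∑ j ∈ Finset.range r, if j < r then ((k + 1).multichoose j : ℝ) * ε ^ j else 0) :=
    hasSum_sum_of_ne_finset_zero fun j hj => if_neg fun h => hj (Finset.mem_range.2 h)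
  have hd : (fun j => if r ≤ j then ((k + 1 + j - 1).choose j : ℝ) * ε ^ j else 0) =
      fun j => ((k + 1).multichoose j : ℝ) * ε ^ j -
        if j < r then ((k + 1).multichoose j : ℝ) * ε ^ j else 0 := by
    ext j
    rw [Nat.multichoose_eq]
    by_cases h : j < r
    · simp [h]
    · simp [h, not_lt.1 h]
  rw [Ireg, hd, (hs.sub hf).tsum_eq, negBinTail, mul_sub, mul_one_div_cancel hne]
  congr 2
  exact Finset.sum_congr rfl fun j hj => if_pos (Finset.mem_range.1 hj)

/-- Increments of a sequence, the first one being its initial value. -/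
def increment (G : ℕ → ℝ) : ℕ → ℝ
  | 0 => G 0
  | j + 1 => G (j + 1) - G j

lemma sum_increment (G : ℕ → ℝ) (k : ℕ) : ∑ j ∈ Finset.range (k + 1), increment G j = G k := by
  induction k with
  | zero => simp [increment]
  | succ k ih => rw [Finset.sum_range_succ, ih]; simp [increment]

lemma increment_nonneg {G : ℕ → ℝ} (h0 : 0 ≤ G 0) (hG : Monotone G) (j : ℕ) :
    0 ≤ increment G j := by
  cases j with
  | zero => exact h0
  | succ j => exact sub_nonneg.2 (hG j.le_succ)

lemma sum_increment_negBinTail (ε : ℝ) (n s : ℕ) :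
    ∑ j ∈ Finset.range (s + 1), increment (fun k => negBinTail ε n (s - k)) j * ε ^ j =
      negBinTail ε (n + 1) s := by
  induction s with
  | zero => simp [increment, negBinTail_zero_right]
  | succ s ih =>
    rw [Finset.sum_range_succ'] at ih
    rw [negBinTail_succ_succ, ← ih, Finset.sum_range_succ', Finset.sum_range_succ']
    simp only [increment, Nat.sub_zero, pow_zero, mul_one, zero_add, Nat.add_sub_add_right,
      Nat.add_sub_cancel, pow_succ, mul_add, Finset.mul_sum]
    have : ∀ a b : ℝ, ∀ c : ℕ, a * (b ^ c * b * b) = b * (a * (b ^ c * b)) := by intros; ring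
    simp only [this, one_mul]
    ring

lemma monotone_negBinTail_sub {ε : ℝ} (h0 : 0 ≤ ε) (h1 : ε ≤ 1) (n s : ℕ) :
    Monotone fun k => negBinTail ε n (s - k) := fun _ _ h =>
  antitone_nat_of_succ_le (negBinTail_succ_le h0 h1 n) (Nat.sub_le_sub_left h s)

/-- Bounds on upper orthant counts bound sums of products of monotone functions. -/
lemma sum_prod_le_of_orthant_card_le {ι α : Type*} [Fintype ι] [DecidableEq ι] [Fintype α]
    {G : ι → ℕ → ℝ} (h0 : ∀ i, 0 ≤ G i 0) (hG : ∀ i, Monotone (G i)) {S : ι → ℕ}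
    {K : α → ι → ℕ} (hK : ∀ x i, K x i ≤ S i) {B : (ι → ℕ) → ℝ}
    (hB : ∀ j : ι → ℕ, ((Finset.univ.filter fun x => ∀ i, j i ≤ K x i).card : ℝ) ≤ B j) :
    ∑ x, ∏ i, G i (K x i) ≤
      ∑ j ∈ Fintype.piFinset fun i => Finset.range (S i + 1),
        (∏ i, increment (G i) (j i)) * B j := by
  have expand : ∀ x, ∏ i, G i (K x i) =
      ∑ j ∈ Fintype.piFinset fun i => Finset.range (S i + 1),
        if ∀ i, j i ≤ K x i then ∏ i, increment (G i) (j i) else 0 := by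
    intro x
    rw [Finset.prod_congr rfl fun i _ => (sum_increment (G i) (K x i)).symm,
      Finset.prod_univ_sum, ← Finset.sum_filter]
    refine Finset.sum_congr ?_ fun _ _ => rfl
    ext j
    simp only [Fintype.mem_piFinset, Finset.mem_range, Finset.mem_filter, Nat.lt_succ_iff]
    exact ⟨fun h => ⟨fun i => (h i).trans (hK x i), h⟩, fun h => h.2⟩
  simp only [expand]
  rw [Finset.sum_comm]
  refine Finset.sum_le_sum fun j _ => ?_
  rw [← Finset.sum_filter, Finset.sum_const, nsmul_eq_mul, mul_comm]
  exact mul_le_mul_of_nonneg_left (hB j)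
    (Finset.prod_nonneg fun i _ => increment_nonneg (h0 i) (hG i) _)

lemma card_le_div_add_one_of_congr {m q : ℕ} (A : Finset (Fin m))
    (hA : ∀ x ∈ A, ∀ y ∈ A, (q : ℤ) ∣ ((x : ℕ) : ℤ) - ((y : ℕ) : ℤ)) :
    A.card ≤ m / q + 1 := by
  rw [← Finset.card_range (m / q + 1)]
  refine Finset.card_le_card_of_injOn (fun x => (x : ℕ) / q) ?_ ?_
  · intro x _
    simpa [Nat.lt_succ_iff] using Nat.div_le_div_right x.2.le
  · intro x hx y hy hxy
    have hmod : (y : ℕ) % q = (x : ℕ) % q :=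
      (Nat.modEq_iff_dvd.2 (hA x hx y hy))
    apply Fin.ext
    have hdiv : (x : ℕ) / q = (y : ℕ) / q := hxy
    rw [← Nat.div_add_mod (x : ℕ) q, ← Nat.div_add_mod (y : ℕ) q, hmod, hdiv]

/-- Value at `x` of the multilinear polynomial with coefficients `c`. -/
def multilinearEval {n : ℕ} (c : (Fin n → Fin 2) → ℤ) (x : Fin n → ℤ) : ℤ :=
  ∑ b, c b * ∏ i, x i ^ (b i : ℕ)

/-- Coefficients of the multilinear polynomial after the substitution of `a` for its first
variable. -/
def specializeFirst {n : ℕ} (c : (Fin (n + 1) → Fin 2) → ℤ) (a : ℤ) (b : Fin n → Fin 2) : ℤ :=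
  c (Fin.cons 0 b) + a * c (Fin.cons 1 b)

lemma multilinearEval_cons {n : ℕ} (c : (Fin (n + 1) → Fin 2) → ℤ) (a : ℤ) (y : Fin n → ℤ) :
    multilinearEval c (Fin.cons a y) = multilinearEval (specializeFirst c a) y := by
  unfold multilinearEval specializeFirst
  rw [← (Fin.consEquiv fun _ => Fin 2).sum_comp, Fintype.sum_prod_type, Fin.sum_univ_two,
    ← Finset.sum_add_distrib]
  refine Finset.sum_congr rfl fun b _ => ?_
  simp [Fin.consEquiv, Fin.prod_univ_succ]
  ring

lemma pow_dvd_of_dvd_mul_of_not_dvd {p a b : ℤ} {k j : ℕ} (hp : Prime p)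
    (hab : p ^ (k + j) ∣ a * b) (hb : ¬ p ^ (k + 1) ∣ b) : p ^ j ∣ a := by
  rw [pow_dvd_iff_le_emultiplicity, emultiplicity_mul hp] at hab
  rw [pow_dvd_iff_le_emultiplicity] at hb ⊢
  generalize emultiplicity p a = u at *
  generalize emultiplicity p b = v at *
  cases u with
  | top => exact le_top
  | coe u =>
    cases v with
    | top => exact absurd le_top hb
    | coe v =>
      norm_cast at *
      omega

lemma dvd_sub_of_dvd_specializeFirst {n p k j : ℕ} (hp : p.Prime)
    {c : (Fin (n + 1) → Fin 2) → ℤ} (hc : ¬ ∀ b, (p : ℤ) ^ (k + 1) ∣ c b) {x y : ℤ}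
    (hx : ∀ b, (p : ℤ) ^ (k + j) ∣ specializeFirst c x b)
    (hy : ∀ b, (p : ℤ) ^ (k + j) ∣ specializeFirst c y b) : (p : ℤ) ^ j ∣ x - y := by
  rcases Nat.eq_zero_or_pos j with rfl | hj
  · simp
  have hlin : ¬ ∀ b, (p : ℤ) ^ (k + 1) ∣ c (Fin.cons 1 b) := by
    intro h
    refine hc fun b => ?_
    have h1 := h (Fin.tail b)
    rw [← Fin.cons_self_tail b]
    rcases Fin.exists_fin_two.1 ⟨b 0, rfl⟩ with h0 | h0 <;> rw [h0]
    · have h2 := (pow_dvd_pow (p : ℤ) (Nat.add_le_add_left hj k)).trans (hx (Fin.tail b))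
      exact (dvd_add_left (h1.mul_left x)).1 h2
    · exact h1
  push Not at hlin
  obtain ⟨b, hb⟩ := hlin
  refine pow_dvd_of_dvd_mul_of_not_dvd (Nat.prime_iff_prime_int.1 hp) ?_ hb
  have hsub : (x - y) * c (Fin.cons 1 b) = specializeFirst c x b - specializeFirst c y b := by
    unfold specializeFirst
    ring
  exact hsub ▸ dvd_sub (hx b) (hy b)

lemma card_filter_fin_succ {n : ℕ} {α : Type*} [Fintype α] (P : (Fin (n + 1) → α) → Prop)
    [DecidablePred P] :
    (Finset.univ.filter P).card =
      ∑ a, (Finset.univ.filter fun y : Fin n → α => P (Fin.cons a y)).card := by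
  simp only [Finset.card_filter]
  rw [← (Fin.consEquiv fun _ => α).sum_comp, Fintype.sum_prod_type]
  rfl

lemma card_dvd_specializeFirst_le {ι : Type*} [Fintype ι] {n m : ℕ} {p : ι → ℕ}
    (hp : ∀ i, (p i).Prime) (hinj : Function.Injective p) {k : ι → ℕ}
    {c : (Fin (n + 1) → Fin 2) → ℤ} (j : ι → ℕ)
    (hc : ∀ i, j i ≠ 0 → ¬ ∀ b, (p i : ℤ) ^ (k i + 1) ∣ c b) {A : Finset (Fin m)}
    (hA : ∀ x ∈ A, ∀ i, j i ≠ 0 → ∀ b, (p i : ℤ) ^ (k i + j i) ∣ specializeFirst c (x : ℕ) b) :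
    (A.card : ℝ) ≤ 1 + m * ∏ i, (1 / (p i : ℝ)) ^ j i := by
  have hcard := card_le_div_add_one_of_congr (q := ∏ i, p i ^ j i) A (by
    intro x hx y hy
    push_cast
    refine Finset.prod_dvd_of_coprime ?_ ?_
    · intro i _ i' _ h
      exact (Nat.isCoprime_iff_coprime.2
        ((Nat.coprime_primes (hp i) (hp i')).2 (hinj.ne h))).pow
    · intro i _
      rcases eq_or_ne (j i) 0 with h | h
      · simp [h]
      · exact dvd_sub_of_dvd_specializeFirst (hp i) (hc i h) (hA x hx i h) (hA y hy i h))
  calc (A.card : ℝ) ≤ ((m / ∏ i, p i ^ j i : ℕ) : ℝ) + 1 := by exact_mod_cast hcard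
    _ ≤ (m : ℝ) / (∏ i, p i ^ j i : ℕ) + 1 := by gcongr; exact Nat.cast_div_le
    _ = 1 + m * ∏ i, (1 / (p i : ℝ)) ^ j i := by
      push_cast
      simp only [one_div, inv_pow, Finset.prod_inv_distrib]
      rw [div_eq_mul_inv, add_comm]

/-- Composite Schwartz-Zippel bound for multilinear polynomials whose coefficients may share
powers of the primes `p i`, with exponents at most `k i`. -/
lemma card_dvd_multilinearEval_le {ι : Type*} [Fintype ι] {m : ℕ} (hm : 0 < m) {p : ι → ℕ}
    (hp : ∀ i, (p i).Prime) (hinj : Function.Injective p) (r : ι → ℕ) (n : ℕ)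
    (c : (Fin n → Fin 2) → ℤ) (k : ι → ℕ)
    (hc : ∀ i, k i < r i → ¬ ∀ b, (p i : ℤ) ^ (k i + 1) ∣ c b) :
    ((Finset.univ.filter fun x : Fin n → Fin m =>
        ∀ i, (p i : ℤ) ^ r i ∣ multilinearEval c fun t => ((x t : ℕ) : ℤ)).card : ℝ) ≤
      (m : ℝ) ^ n * (n / m + ∏ i, negBinTail (1 / (p i : ℝ)) n (r i - k i)) := by
  classical
  have hm' : (0 : ℝ) < m := Nat.cast_pos.2 hm
  have h0 : ∀ i, (0 : ℝ) ≤ 1 / (p i : ℝ) := fun i => by positivity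
  have h1 : ∀ i, 1 / (p i : ℝ) ≤ 1 := fun i =>
    div_le_one_of_le₀ (Nat.one_le_cast.2 (hp i).one_le) (Nat.cast_nonneg _)
  induction n generalizing k with
  | zero =>
    by_cases h : ∃ i, k i < r i
    · obtain ⟨i, hi⟩ := h
      rw [Finset.card_eq_zero.2]
      · have := Finset.prod_nonneg fun i (_ : i ∈ Finset.univ) =>
          negBinTail_nonneg (h0 i) (h1 i) 0 (r i - k i)
        simpa using this
      · refine Finset.filter_eq_empty_iff.2 fun x _ hx => hc i hi fun b => ?_
        have := (pow_dvd_pow (p i : ℤ) (Nat.succ_le_of_lt hi)).trans (hx i)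
        have hval : multilinearEval c (fun t => ((x t : ℕ) : ℤ)) = c b := by
          rw [multilinearEval, Fintype.sum_subsingleton _ b]
          simp
        rwa [hval] at this
    · push Not at h
      have hs : ∀ i, r i - k i = 0 := fun i => Nat.sub_eq_zero_of_le (h i)
      simp only [hs, negBinTail_zero_right]
      simpa using Finset.card_le_univ (α := Fin 0 → Fin m) _
  | succ n ih =>
    set K : Fin m → ι → ℕ := fun a i => Nat.findGreatest
      (fun j => ∀ b, (p i : ℤ) ^ (k i + j) ∣ specializeFirst c (a : ℕ) b) (r i - k i)
    have hKle : ∀ a i, K a i ≤ r i - k i := fun a i => Nat.findGreatest_le _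
    have hspec : ∀ a i j, j ≠ 0 → j ≤ K a i →
        ∀ b, (p i : ℤ) ^ (k i + j) ∣ specializeFirst c (a : ℕ) b := by
      intro a i j hj hja b
      have hne : K a i ≠ 0 := by omega
      exact (pow_dvd_pow _ (Nat.add_le_add_left hja _)).trans (Nat.findGreatest_of_ne_zero rfl hne b)
    have slice : ∀ a : Fin m, ((Finset.univ.filter fun y : Fin n → Fin m => ∀ i, (p i : ℤ) ^ r i ∣
          multilinearEval c fun t => (((Fin.cons a y : Fin (n + 1) → Fin m) t : ℕ) : ℤ)).card : ℝ) ≤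
        (m : ℝ) ^ n * (n / m + ∏ i, negBinTail (1 / (p i : ℝ)) n (r i - k i - K a i)) := by
      intro a
      have hcons : ∀ y : Fin n → Fin m,
          (fun t => (((Fin.cons a y : Fin (n + 1) → Fin m) t : ℕ) : ℤ)) =
            Fin.cons ((a : ℕ) : ℤ) fun t => ((y t : ℕ) : ℤ) := fun y => by
        ext t
        cases t using Fin.cases <;> rfl
      simp only [hcons, multilinearEval_cons, Nat.sub_sub]
      refine ih _ (fun i => k i + K a i) fun i hi => ?_
      rw [add_assoc]
      exact Nat.findGreatest_is_greatest (Nat.lt_succ_self _) (by change K a i + 1 ≤ _; omega)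
    have average := sum_prod_le_of_orthant_card_le
      (G := fun i j => negBinTail (1 / (p i : ℝ)) n (r i - k i - j))
      (fun i => negBinTail_nonneg (h0 i) (h1 i) _ _)
      (fun i => monotone_negBinTail_sub (h0 i) (h1 i) _ _) hKle
      (B := fun j => if ∀ i, j i ≤ r i - k i then 1 + m * ∏ i, (1 / (p i : ℝ)) ^ j i else 0) (by
        intro j
        split_ifs with hj
        · refine card_dvd_specializeFirst_le hp hinj j (k := k) (c := c)
            (fun i hi => hc i ?_) fun x hx i hi => ?_
          · have := hj i
            omega
          · exact hspec x i _ hi ((Finset.mem_filter.1 hx).2 i)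
        · rw [Finset.filter_eq_empty_iff.2 fun x _ hx => hj fun i => (hx i).trans (hKle x i)]
          simp)
    have total : (∑ j ∈ Fintype.piFinset fun i => Finset.range (r i - k i + 1),
        (∏ i, increment (fun j => negBinTail (1 / (p i : ℝ)) n (r i - k i - j)) (j i)) *
          if ∀ i, j i ≤ r i - k i then 1 + m * ∏ i, (1 / (p i : ℝ)) ^ j i else 0) =
        1 + m * ∏ i, negBinTail (1 / (p i : ℝ)) (n + 1) (r i - k i) := by
      simp only [← sum_increment_negBinTail]
      have hone : ∏ i, ∑ j ∈ Finset.range (r i - k i + 1),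
          increment (fun j => negBinTail (1 / (p i : ℝ)) n (r i - k i - j)) j = 1 := by
        simp [sum_increment, negBinTail_zero_right]
      refine Eq.trans ?_ (congrArg (fun t : ℝ => t + _) hone)
      rw [Finset.prod_univ_sum, Finset.prod_univ_sum, Finset.mul_sum, ← Finset.sum_add_distrib]
      refine Finset.sum_congr rfl fun j hj => ?_
      rw [if_pos fun i => Nat.lt_succ_iff.1 (Finset.mem_range.1 (Fintype.mem_piFinset.1 hj i)),
        Finset.prod_mul_distrib]
      ring
    rw [total] at average
    rw [card_filter_fin_succ, Nat.cast_sum]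
    refine (Finset.sum_le_sum fun a _ => slice a).trans ?_
    rw [← Finset.mul_sum, Finset.sum_add_distrib, Finset.sum_const, Finset.card_univ,
      Fintype.card_fin, nsmul_eq_mul, mul_div_cancel₀ _ hm'.ne']
    calc _ ≤ (m : ℝ) ^ n *
          (n + (1 + m * ∏ i, negBinTail (1 / (p i : ℝ)) (n + 1) (r i - k i))) := by gcongr
      _ = _ := by
        push_cast
        field_simp
        ring

lemma exists_eq_equivFunOnFinite_symm {n : ℕ} {d : Fin n →₀ ℕ} (hd : ∀ i, d i ≤ 1) :
    ∃ b : Fin n → Fin 2, Finsupp.equivFunOnFinite.symm (fun i => (b i : ℕ)) = d :=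
  ⟨fun i => ⟨d i, Nat.lt_succ_of_le (hd i)⟩, by ext; simp⟩

lemma eval_eq_multilinearEval {n : ℕ} {f : MvPolynomial (Fin n) ℤ}
    (hlin : ∀ d ∈ f.support, ∀ i, d i ≤ 1) (x : Fin n → ℤ) :
    MvPolynomial.eval x f = multilinearEval
      (fun b => f.coeff (Finsupp.equivFunOnFinite.symm fun i => (b i : ℕ))) x := by
  have hinj : Function.Injective fun b : Fin n → Fin 2 =>
      Finsupp.equivFunOnFinite.symm fun i => (b i : ℕ) := by
    intro b b' h
    ext i
    simpa using DFunLike.congr_fun h i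
  rw [MvPolynomial.eval_eq', multilinearEval]
  trans ∑ d ∈ Finset.univ.map ⟨_, hinj⟩, f.coeff d * ∏ i, x i ^ d i
  · refine Finset.sum_subset (fun d hd => ?_) fun d _ hd => ?_
    · obtain ⟨b, rfl⟩ := exists_eq_equivFunOnFinite_symm (hlin d hd)
      exact Finset.mem_map_of_mem _ (Finset.mem_univ b)
    · rw [MvPolynomial.notMem_support_iff.1 hd, zero_mul]
  · rw [Finset.sum_map]
    rfl

open Classical in
/-- Multilinear Composite Schwartz-Zippel: for `N = ∏ pᵢ^{rᵢ}` a prime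
factorization, `f` a μ-linear integer polynomial whose content is coprime to
`N`, and `x` uniform on `{0,...,m-1}^μ` with `m > 1`:
`P[f(x) ≡ 0 (mod N)] ≤ μ/m + ∏ᵢ I_{1/pᵢ}(rᵢ, μ)`. -/
theorem stmt8 (μn ℓ m : ℕ) (hμ : 1 ≤ μn) (hm : 1 < m)
    (p r : Fin ℓ → ℕ) (hp : ∀ i, (p i).Prime) (hr : ∀ i, 1 ≤ r i)
    (hinj : Function.Injective p)
    (N : ℕ) (hN : N = ∏ i, p i ^ r i)
    (f : MvPolynomial (Fin μn) ℤ)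
    (hlin : ∀ d ∈ f.support, ∀ i, d i ≤ 1)
    (hcop : Int.gcd (f.support.gcd f.coeff) (N : ℤ) = 1) :
    ((Finset.univ.filter
          (fun x : Fin μn → Fin m =>
            (MvPolynomial.eval (fun i => ((x i : ℕ) : ℤ)) f) % (N : ℤ) = 0)).card : ℝ)
        / (m : ℝ) ^ μn
      ≤ (μn : ℝ) / m + ∏ i, Ireg (1 / (p i : ℝ)) (r i) μn := by
  have hm0 : (0 : ℝ) < m := by positivity
  have hp1 : ∀ i, 1 / (p i : ℝ) < 1 := fun i =>
    (div_lt_one (Nat.cast_pos.2 (hp i).pos)).2 (Nat.one_lt_cast.2 (hp i).one_lt)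
  have hbound := card_dvd_multilinearEval_le (m := m) (by omega) hp hinj r μn
    (fun b => f.coeff (Finsupp.equivFunOnFinite.symm fun i => (b i : ℕ))) (fun _ => 0) (by
      intro i _ h
      simp only [zero_add, pow_one] at h
      have hgcd : (p i : ℤ) ∣ f.support.gcd f.coeff := by
        refine Finset.dvd_gcd fun d hd => ?_
        obtain ⟨b, rfl⟩ := exists_eq_equivFunOnFinite_symm (hlin d hd)
        exact h b
      have hpN : (p i : ℤ) ∣ N := by
        rw [hN, Int.natCast_dvd_natCast]
        exact (dvd_pow_self _ (Nat.one_le_iff_ne_zero.1 (hr i))).trans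
          (Finset.dvd_prod_of_mem _ (Finset.mem_univ i))
      have := Int.dvd_coe_gcd hgcd hpN
      rw [hcop] at this
      exact (hp i).one_lt.ne' (Nat.dvd_one.1 (by exact_mod_cast this)))
  simp only [Nat.sub_zero, ← eval_eq_multilinearEval hlin,
    ← Ireg_eq_negBinTail (h0 := (by positivity : (0 : ℝ) ≤ 1 / (p _ : ℝ))) (hp1 _) _ hμ] at hbound
  rw [div_le_iff₀' (by positivity)]
  refine le_trans (Nat.cast_le.2 (Finset.card_le_card ?_)) hbound
  refine Finset.monotone_filter_right _ fun x _ hx i => ?_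
  have hdvd : (p i : ℤ) ^ r i ∣ N := by
    rw [hN]
    exact_mod_cast Finset.dvd_prod_of_mem (fun i => p i ^ r i) (Finset.mem_univ i)
  exact hdvd.trans (Int.dvd_of_emod_eq_zero hx)
end

section
/- For μ ≥ 2 and ε ∈ (0,1), let B_{μ,ε} = {(p,r) : p prime, p < μ^{1+ε}, 0 ≤ r ≤ 2(1+ε)·μ·ln(μ)/ln(p)}. Then Σ_{(p,r)∈B_{μ,ε}} log₂ p ≤ 4·μ^{2+ε}. -/
open scoped Nat

/-- The primes below `140`. -/
def sievePrimes : List ℕ :=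
  [2, 3, 5, 7, 11, 13, 17, 19, 23, 29, 31, 37, 41, 43, 47, 53, 59, 61, 67, 71, 73, 79, 83, 89, 97,
   101, 103, 107, 109, 113, 127, 131, 137, 139]

/-- The product of `sievePrimes`. -/
def sieveProduct : ℕ :=
  10014646650599190067509233131649940057366334653200433090

/-- A necessary condition for primality: being coprime to `sieveProduct`, or in `sievePrimes`. -/
def sieveTest (n : ℕ) : Bool :=
  (Nat.gcd n sieveProduct).beq 1 || (n.ble 139 && sievePrimes.any fun p => p.beq n)

/-- The number of `n ∈ [a, a + k)` passing `sieveTest`. -/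
def sieveCount (a : ℕ) : ℕ → ℕ
  | 0 => 0
  | k + 1 => sieveCount a k + cond (sieveTest (a + k)) 1 0

/-- Application of `f` to `n`, by recursion on `n`, which makes the kernel evaluate `n` first. -/
def applyForced {α : Type} (n : ℕ) (f : ℕ → α) : α :=
  Nat.rec (f 0) (fun k _ => f (Nat.succ k)) n

/-- Verifies, on consecutive blocks `[a, a + a / 48]`, an integer form of
`π n * (2 * m + 1) * log₂ n ≤ 4 * m * n`, where `c` bounds the number of primes below `a`. -/
def verifyBlocks : ℕ → ℕ → ℕ → ℕ → Bool
  | 0, a, _, _ => Nat.ble 131072 a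
  | fuel + 1, a, c, m =>
    applyForced (a + a / 48) fun b =>
    applyForced (c + sieveCount a (a / 48 + 1)) fun c' =>
    applyForced (cond (Nat.ble (m * m) (b + 1)) (m + 1) m) fun m' =>
    Nat.ble (c' * (2 * m + 1) * (Nat.log2 (b ^ 32) + 1)) (4 * m * a * 32) &&
      verifyBlocks fuel (b + 1) c' m'

theorem verifyBlocks_eq_true : verifyBlocks 409 2 0 2 = true := by
  decide +kernel

theorem applyForced_eq {α : Type} (n : ℕ) (f : ℕ → α) : applyForced n f = f n := by
  cases n <;> rfl

theorem sieveTest_of_prime {p : ℕ} (hp : p.Prime) : sieveTest p = true := by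
  have hprod : sieveProduct = sievePrimes.prod := by decide +kernel
  have hprime : ∀ q ∈ sievePrimes, q.Prime ∧ q ≤ 139 := by
    simp only [sievePrimes, List.forall_mem_cons]
    norm_num
  by_cases h : p ∣ sieveProduct
  · rw [hprod, hp.prime.dvd_prod_iff] at h
    obtain ⟨q, hq, hpq⟩ := h
    obtain rfl := (Nat.prime_dvd_prime_iff_eq hp (hprime q hq).1).1 hpq
    simp only [sieveTest, Bool.or_eq_true, Bool.and_eq_true, List.any_eq_true]
    exact Or.inr ⟨Nat.ble_eq ▸ (hprime p hq).2, p, hq, Nat.beq_refl p⟩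
  · have := (hp.coprime_iff_not_dvd).2 h
    simp [sieveTest, Nat.coprime_iff_gcd_eq_one.1 this]

theorem primeCounting'_add_le_sieveCount (a k : ℕ) :
    Nat.primeCounting' (a + k) ≤ Nat.primeCounting' a + sieveCount a k := by
  induction k with
  | zero => simp [sieveCount]
  | succ k ih =>
    have h : Nat.primeCounting' (a + (k + 1)) =
        Nat.primeCounting' (a + k) + if (a + k).Prime then 1 else 0 :=
      Nat.count_succ _ _
    rw [h, sieveCount]
    split_ifs with hp
    · rw [sieveTest_of_prime hp]
      simp only [cond_true]
      omega
    · omega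

theorem logb_two_le_log2_pow {b k : ℕ} (hb : 0 < b) (hk : 0 < k) :
    Real.logb 2 b ≤ ((Nat.log2 (b ^ k) + 1 : ℕ) : ℝ) / k := by
  have hlt : b ^ k < 2 ^ (Nat.log2 (b ^ k) + 1) := Nat.lt_log2_self
  have hlt' : ((b : ℝ) ^ k) ≤ 2 ^ (Nat.log2 (b ^ k) + 1) := by exact_mod_cast hlt.le
  have hb' : (0 : ℝ) < b := by exact_mod_cast hb
  have h := Real.logb_le_logb_of_le (b := 2) (by norm_num) (by positivity) hlt'
  rw [Real.logb_pow, Real.logb_pow, Real.logb_self_eq_one (by norm_num), mul_one] at h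
  rw [le_div_iff₀ (by exact_mod_cast hk), mul_comm]
  exact h

theorem primeCounting_mul_logb_le_of_verifyBlocks (fuel a c m : ℕ)
    (hv : verifyBlocks fuel a c m = true) (hc : Nat.primeCounting' a ≤ c) (ha : 2 ≤ a)
    (hm : 1 ≤ m) (hma : (m - 1) * (m - 1) ≤ a) {n M : ℕ} (han : a ≤ n) (hn : n < 131072)
    (hM : n < M * M) :
    (Nat.primeCounting n : ℝ) * (2 * M + 1) * Real.logb 2 n ≤ 4 * M * n := by
  induction fuel generalizing a c m with
  | zero =>
    simp only [verifyBlocks, Nat.ble_eq] at hv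
    omega
  | succ fuel ih =>
    simp only [verifyBlocks, applyForced_eq, Bool.and_eq_true, Nat.ble_eq] at hv
    obtain ⟨hineq, hrest⟩ := hv
    have hcount := primeCounting'_add_le_sieveCount a (a / 48 + 1)
    set c' := c + sieveCount a (a / 48 + 1) with hc'
    set b := a + a / 48 with hb
    have hcb : Nat.primeCounting' (b + 1) ≤ c' := by
      rw [hb, add_assoc]
      omega
    by_cases hnb : n ≤ b
    · have hmM : m ≤ M := by
        by_contra! hlt
        have : M ≤ m - 1 := by omega
        have := Nat.mul_le_mul this this
        omega
      have hpi : Nat.primeCounting n ≤ c' :=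
        (Nat.monotone_primeCounting' (Nat.succ_le_succ hnb)).trans hcb
      have hbpos : 0 < b := by omega
      have hlog : Real.logb 2 n ≤ ((Nat.log2 (b ^ 32) + 1 : ℕ) : ℝ) / (32 : ℕ) :=
        (Real.logb_le_logb_of_le (by norm_num) (by exact_mod_cast (by omega : 0 < n))
          (by exact_mod_cast hnb)).trans (logb_two_le_log2_pow hbpos (by norm_num))
      set l := Nat.log2 (b ^ 32) + 1
      have hlog0 : 0 ≤ Real.logb 2 n :=
        Real.logb_nonneg (by norm_num) (by exact_mod_cast (by omega : 1 ≤ n))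
      have hnat : c' * (2 * M + 1) * l ≤ 4 * M * n * 32 := by
        have h1 : m * (c' * (2 * M + 1) * l) ≤ m * (4 * M * n * 32) := by
          calc m * (c' * (2 * M + 1) * l) = c' * l * (2 * (m * M) + m) := by ring
            _ ≤ c' * l * (2 * (m * M) + M) := by gcongr
            _ = M * (c' * (2 * m + 1) * l) := by ring
            _ ≤ M * (4 * m * a * 32) := by gcongr
            _ ≤ M * (4 * m * n * 32) := by gcongr
            _ = m * (4 * M * n * 32) := by ring
        exact Nat.le_of_mul_le_mul_left h1 hm
      have hreal : (c' : ℝ) * (2 * M + 1) * l ≤ 4 * M * n * 32 := by exact_mod_cast hnat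
      calc (Nat.primeCounting n : ℝ) * (2 * M + 1) * Real.logb 2 n
          ≤ c' * (2 * M + 1) * (l / (32 : ℕ)) := by gcongr
        _ = c' * (2 * M + 1) * l / 32 := by push_cast; ring
        _ ≤ 4 * M * n := by rw [div_le_iff₀ (by norm_num)]; exact hreal
    · refine ih (b + 1) c' _ hrest hcb (by omega) ?_ ?_ (by omega)
      · cases Nat.ble (m * m) (b + 1) <;> simp [hm]
      · cases h : Nat.ble (m * m) (b + 1)
        · simp only [cond_false]
          omega
        · rw [Nat.ble_eq] at h
          simpa using h

theorem primeCounting_mul_logb_le_of_lt {n M : ℕ} (h2 : 2 ≤ n) (hn : n < 131072)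
    (hM : n < M * M) :
    (Nat.primeCounting n : ℝ) * (2 * M + 1) * Real.logb 2 n ≤ 4 * M * n :=
  primeCounting_mul_logb_le_of_verifyBlocks 409 2 0 2 verifyBlocks_eq_true (by decide) le_rfl
    (by norm_num) (by norm_num) h2 hn hM

theorem factorial_six_mul_le (n : ℕ) :
    (6 * n)! ≤ 432 ^ n * ((3 * n)! * (2 * n)! * n !) := by
  induction n with
  | zero => simp
  | succ n ih =>
    have h6 : (6 * (n + 1))! = (6 * n + 6) * ((6 * n + 5) * ((6 * n + 4) * ((6 * n + 3) *
        ((6 * n + 2) * ((6 * n + 1) * (6 * n)!))))) := by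
      rw [show 6 * (n + 1) = 6 * n + 6 by ring]
      simp only [Nat.factorial_succ]
    have h3 : (3 * (n + 1))! = (3 * n + 3) * ((3 * n + 2) * ((3 * n + 1) * (3 * n)!)) := by
      rw [show 3 * (n + 1) = 3 * n + 3 by ring]
      simp only [Nat.factorial_succ]
    have h2 : (2 * (n + 1))! = (2 * n + 2) * ((2 * n + 1) * (2 * n)!) := by
      rw [show 2 * (n + 1) = 2 * n + 2 by ring]
      simp only [Nat.factorial_succ]
    rw [h6, h3, h2, Nat.factorial_succ]
    have hpoly : (6 * n + 1) * (6 * n + 5) ≤ 36 * (n + 1) ^ 2 := by nlinarith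
    calc _ = (72 * (n + 1) * (3 * n + 1) * (3 * n + 2) * (2 * n + 1)) *
          ((6 * n + 1) * (6 * n + 5)) * (6 * n)! := by ring
      _ ≤ (72 * (n + 1) * (3 * n + 1) * (3 * n + 2) * (2 * n + 1)) *
          (36 * (n + 1) ^ 2) * (432 ^ n * ((3 * n)! * (2 * n)! * n !)) := by gcongr
      _ = _ := by ring

theorem add_div_add_div_le_six_mul_div (n d : ℕ) :
    3 * n / d + 2 * n / d + n / d ≤ 6 * n / d := by
  have h1 := Nat.div_add_div_le_add_div (x := 3 * n) (y := 2 * n) (z := d)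
  have h2 := Nat.div_add_div_le_add_div (x := 3 * n + 2 * n) (y := n) (z := d)
  rw [show 3 * n + 2 * n + n = 6 * n by ring] at h2
  omega

theorem add_div_add_div_lt_six_mul_div {n p : ℕ} (h1 : n < p) (h2 : p ≤ 6 * n) :
    3 * n / p + 2 * n / p + n / p < 6 * n / p := by
  have hp : 0 < p := by omega
  have ha : 2 * n / p < 2 := (Nat.div_lt_iff_lt_mul hp).2 (by omega)
  have hb : 3 * n / p < 3 := (Nat.div_lt_iff_lt_mul hp).2 (by omega)
  have hc : n / p = 0 := Nat.div_eq_of_lt h1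
  have ha' := Nat.div_mul_le_self (2 * n) p
  have hb' := Nat.div_mul_le_self (3 * n) p
  rw [hc, add_zero, ← Nat.succ_le_iff, Nat.le_div_iff_mul_le hp]
  interval_cases 2 * n / p <;> interval_cases 3 * n / p <;> omega

theorem prime_dvd_of_factorial_six_mul_eq {n p K : ℕ} (hp : p.Prime) (h1 : n < p)
    (h2 : p ≤ 6 * n) (hK : (6 * n)! = K * ((3 * n)! * (2 * n)! * n !)) : p ∣ K := by
  have : Fact p.Prime := ⟨hp⟩
  have hK0 : K ≠ 0 := by
    rintro rfl
    simp [Nat.factorial_ne_zero] at hK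
  have hval := congrArg (padicValNat p) hK
  have hlog {j : ℕ} (hj : j ≤ 6 * n) : Nat.log p j < Nat.log p (6 * n) + 1 :=
    Nat.lt_succ_of_le (Nat.log_mono_right hj)
  rw [padicValNat.mul hK0 (by positivity), padicValNat.mul (by positivity) (by positivity),
    padicValNat.mul (by positivity) (by positivity), padicValNat_factorial (hlog le_rfl),
    padicValNat_factorial (hlog (j := 3 * n) (by omega)),
    padicValNat_factorial (hlog (j := 2 * n) (by omega)),
    padicValNat_factorial (hlog (j := n) (by omega)),
    ← Finset.sum_add_distrib, ← Finset.sum_add_distrib] at hval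
  have hlt : ∑ i ∈ Finset.Ico 1 (Nat.log p (6 * n) + 1),
      (3 * n / p ^ i + 2 * n / p ^ i + n / p ^ i) <
      ∑ i ∈ Finset.Ico 1 (Nat.log p (6 * n) + 1), 6 * n / p ^ i := by
    refine Finset.sum_lt_sum (fun i _ => add_div_add_div_le_six_mul_div n _) ⟨1, ?_, ?_⟩
    · have := Nat.log_pos hp.one_lt h2
      simp only [Finset.mem_Ico]
      omega
    · simpa using add_div_add_div_lt_six_mul_div h1 h2
  exact dvd_of_one_le_padicValNat (by omega)

theorem primorial_six_mul_le (n : ℕ) : primorial (6 * n) ≤ primorial n * 432 ^ n := by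
  obtain ⟨K, hK⟩ : (3 * n)! * (2 * n)! * n ! ∣ (6 * n)! := by
    have h1 := Nat.factorial_mul_factorial_dvd_factorial_add (3 * n) (2 * n)
    have h2 := Nat.factorial_mul_factorial_dvd_factorial_add (3 * n + 2 * n) n
    rw [show 3 * n + 2 * n + n = 6 * n by ring] at h2
    exact (mul_dvd_mul_right h1 _).trans h2
  replace hK := hK.trans (mul_comm _ K)
  have hpos : 0 < (3 * n)! * (2 * n)! * n ! := by positivity
  have hKle : K ≤ 432 ^ n := by
    refine Nat.le_of_mul_le_mul_right ?_ hpos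
    rw [← hK]
    exact factorial_six_mul_le n
  have hK0 : 0 < K := by
    refine Nat.pos_of_ne_zero ?_
    rintro rfl
    simp [Nat.factorial_ne_zero] at hK
  have hadd := primorial_add n (5 * n)
  rw [show n + 5 * n = 6 * n by ring] at hadd
  rw [hadd]
  refine Nat.mul_le_mul_left _ ((Nat.le_of_dvd hK0 ?_).trans hKle)
  refine Finset.prod_primes_dvd _ (fun p hp => (Finset.mem_filter.1 hp).2.prime) fun p hp => ?_
  rw [Finset.mem_filter, Finset.mem_Ico] at hp
  exact prime_dvd_of_factorial_six_mul_eq hp.2 (Nat.lt_of_succ_le hp.1.1) (Nat.le_of_lt_succ hp.1.2) hK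

theorem primorial_succ_le (n : ℕ) : primorial (n + 1) ≤ primorial n * (n + 1) := by
  have h := primorial_add n 1
  rw [h]
  gcongr
  rw [Nat.Ico_succ_singleton, Finset.filter_singleton]
  split_ifs <;> simp

theorem primorial_succ_of_not_prime {n : ℕ} (h : ¬ (n + 1).Prime) :
    primorial (n + 1) = primorial n := by
  rw [primorial_add n 1, Nat.Ico_succ_singleton, Finset.filter_singleton, if_neg h]
  simp

theorem primorial_le_mul_sq (n : ℕ) (h : 6 ≤ n) :
    primorial n ≤ primorial (6 * (n / 6)) * (6 * (n / 6) + 6) ^ 2 := by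
  set q := n / 6 with hq
  have hq1 : 1 ≤ q := by omega
  have hnp {k d : ℕ} (hd : d ∣ 6 * q + k + 1) (hd1 : d ≠ 1) (hd5 : d < 6) :
      primorial (6 * q + k + 1) = primorial (6 * q + k) :=
    primorial_succ_of_not_prime fun hp => by
      rcases (Nat.dvd_prime hp).1 hd with h | h <;> omega
  have e2 := hnp (k := 1) (d := 2) (by omega) (by norm_num) (by norm_num)
  have e3 := hnp (k := 2) (d := 3) (by omega) (by norm_num) (by norm_num)
  have e4 := hnp (k := 3) (d := 2) (by omega) (by norm_num) (by norm_num)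
  have hn : n ≤ 6 * q + 4 + 1 := by omega
  calc primorial n ≤ primorial (6 * q + 4 + 1) := primorial_mono hn
    _ ≤ primorial (6 * q + 4) * (6 * q + 4 + 1) := primorial_succ_le _
    _ = primorial (6 * q + 1) * (6 * q + 4 + 1) := by rw [e4, e3, e2]
    _ ≤ primorial (6 * q) * (6 * q + 1) * (6 * q + 4 + 1) := by
      gcongr
      exact primorial_succ_le _
    _ ≤ primorial (6 * q) * (6 * q + 6) * (6 * q + 6) :=
      Nat.mul_le_mul (Nat.mul_le_mul_left _ (by omega)) (by omega)
    _ = primorial (6 * q) * (6 * q + 6) ^ 2 := by ring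

theorem two_mul_log_le {q : ℝ} (hq : 1 ≤ q) :
    2 * Real.log (6 * q + 6) ≤ 7 / 2 * (√(6 * q) - √q) := by
  have hy : 1 ≤ √q := Real.one_le_sqrt.2 hq
  have hsq : √q ^ 2 = q := Real.sq_sqrt (by linarith)
  have h6 : (2.449 : ℝ) ≤ √6 := Real.le_sqrt_of_sq_le (by norm_num)
  have hmul : √(6 * q) = √6 * √q := Real.sqrt_mul (by norm_num) q
  set s := √(6 * q + 6) with hs
  have hs0 : 0 < s := Real.sqrt_pos.2 (by linarith)
  have hssq : s ^ 2 = 6 * q + 6 := Real.sq_sqrt (by linarith)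
  have hlog : Real.log (6 * q + 6) = 2 * Real.log s := by
    rw [← hssq, Real.log_pow]; norm_num
  have hlog4 : Real.log s ≤ s / 4 - 1 + 2 * Real.log 2 := by
    have h1 := Real.log_le_sub_one_of_pos (x := s / 4) (by positivity)
    rw [Real.log_div hs0.ne' (by norm_num), show (4 : ℝ) = 2 ^ 2 by norm_num,
      Real.log_pow] at h1
    norm_num at h1 ⊢
    linarith
  have hl2 := Real.log_two_lt_d9
  have hsle : s ≤ 5.0715 * √q - 1.5453 := by
    refine Real.sqrt_le_iff.2 ⟨by linarith, ?_⟩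
    nlinarith
  have : 2.449 * √q ≤ √6 * √q := by gcongr
  rw [hlog, hmul]
  linarith

theorem log_primorial_le (n : ℕ) :
    Real.log (primorial n) ≤ Real.log 432 / 5 * n + 7 / 2 * √n := by
  induction n using Nat.strong_induction_on with
  | _ n ih =>
  rcases lt_or_ge n 6 with hn | hn
  · have hle : Real.log (primorial n) ≤ n * Real.log 4 := by
      rw [← Real.log_pow]
      exact Real.log_le_log (by exact_mod_cast primorial_pos n)
        (by exact_mod_cast primorial_le_four_pow n)
    have h4 : Real.log 4 = 2 * Real.log 2 := by
      rw [show (4 : ℝ) = 2 ^ 2 by norm_num, Real.log_pow]; norm_num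
    have hl2 := Real.log_two_lt_d9
    have hsq : √(n : ℝ) ^ 2 = n := Real.sq_sqrt (Nat.cast_nonneg n)
    have hs0 : 0 ≤ √(n : ℝ) := Real.sqrt_nonneg _
    have hs : √(n : ℝ) ≤ 2.4 := by
      have : (n : ℝ) ≤ 5 := by exact_mod_cast (by omega : n ≤ 5)
      exact Real.sqrt_le_iff.2 ⟨by norm_num, by norm_num; linarith⟩
    have h432 : 0 ≤ Real.log 432 := Real.log_nonneg (by norm_num)
    have hlast : (n : ℝ) * Real.log 4 ≤ 7 / 2 * √n := by
      rw [h4]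
      nlinarith
    have : 0 ≤ Real.log 432 / 5 * n := by positivity
    linarith
  · set q := n / 6 with hq
    have hq1 : 1 ≤ q := by omega
    have ihq := ih q (by omega)
    have hle : (primorial n : ℝ) ≤ primorial q * 432 ^ q * (6 * q + 6) ^ 2 := by
      exact_mod_cast (primorial_le_mul_sq n hn).trans
        (Nat.mul_le_mul_right _ (primorial_six_mul_le q))
    have hpos : (0 : ℝ) < primorial q := by exact_mod_cast primorial_pos q
    have hlog := Real.log_le_log (by exact_mod_cast primorial_pos n) hle
    rw [Real.log_mul (by positivity) (by positivity),
      Real.log_mul (by positivity) (by positivity), Real.log_pow, Real.log_pow] at hlog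
    have h2 := two_mul_log_le (q := q) (by exact_mod_cast hq1)
    have hqn : 6 * (q : ℝ) ≤ n := by exact_mod_cast Nat.mul_div_le n 6
    have hsqrt : √(6 * (q : ℝ)) ≤ √n := Real.sqrt_le_sqrt hqn
    have h432 : 0 ≤ Real.log 432 := Real.log_nonneg (by norm_num)
    have hmul := mul_le_mul_of_nonneg_left hqn h432
    push_cast at hlog
    linarith

theorem log_primorial_le_linear (n : ℕ) : Real.log (primorial n) ≤ 1.22 * n + 500 := by
  have h := log_primorial_le n
  have h3 : Real.log 3 ≤ 65 / 41 * Real.log 2 := by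
    have := Real.log_le_log (x := 3 ^ 41) (y := 2 ^ 65) (by norm_num) (by norm_num)
    rw [Real.log_pow, Real.log_pow] at this
    push_cast at this
    linarith
  have h432 : Real.log 432 = 4 * Real.log 2 + 3 * Real.log 3 := by
    rw [show (432 : ℝ) = 2 ^ 4 * 3 ^ 3 by norm_num, Real.log_mul (by norm_num) (by norm_num),
      Real.log_pow, Real.log_pow]
    norm_num
  have hl2 := Real.log_two_lt_d9
  have hsq : √(n : ℝ) ^ 2 = n := Real.sq_sqrt (Nat.cast_nonneg n)
  have hc : Real.log 432 / 5 ≤ 1.21387 := by linarith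
  have hmul : Real.log 432 / 5 * n ≤ 1.21387 * n := by gcongr
  nlinarith [sq_nonneg (√(n : ℝ) - 285.5)]

/-- A majorant for `c⁻¹ (π x - θ x / log x) + d / (c log x)`: its derivative is at least
`1 / log x ^ 2` once `6 ≤ log x`. -/
noncomputable def logTail (x : ℝ) : ℝ := x / Real.log x ^ 2 + 4 * x / Real.log x ^ 3

theorem logTail_add_div_log_le {c d a b : ℝ} (hc : 0 ≤ c) (ha : 512 ≤ a) (hab : a ≤ b) :
    c * logTail a - d / Real.log a + (c * a + d) / Real.log a ≤
      c * logTail b - d / Real.log b + (c * a + d) / Real.log b := by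
  have hder {x : ℝ} (hx : 512 ≤ x) : HasDerivAt
      (fun x => c * logTail x - d / Real.log x + (c * a + d) / Real.log x)
      (c * ((1 * Real.log x ^ 2 - x * (2 * Real.log x ^ 1 * x⁻¹)) / (Real.log x ^ 2) ^ 2 +
        (4 * 1 * Real.log x ^ 3 - 4 * x * (3 * Real.log x ^ 2 * x⁻¹)) / (Real.log x ^ 3) ^ 2) -
        (0 * Real.log x - d * x⁻¹) / Real.log x ^ 2 +
        (0 * Real.log x - (c * a + d) * x⁻¹) / Real.log x ^ 2) x := by
    have hx0 : x ≠ 0 := by linarith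
    have hl : Real.log x ≠ 0 := (Real.log_pos (by linarith)).ne'
    have hlog := Real.hasDerivAt_log hx0
    exact ((((hasDerivAt_id x).div (hlog.pow 2) (pow_ne_zero 2 hl)).add
      (((hasDerivAt_id x).const_mul 4).div (hlog.pow 3) (pow_ne_zero 3 hl))).const_mul c).sub
      ((hasDerivAt_const x d).div hlog hl) |>.add ((hasDerivAt_const x (c * a + d)).div hlog hl)
  have hmono : MonotoneOn (fun x => c * logTail x - d / Real.log x + (c * a + d) / Real.log x)
      (Set.Icc a b) := by
    refine monotoneOn_of_hasDerivWithinAt_nonneg (convex_Icc a b)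
      (fun x hx => (hder (ha.trans hx.1)).continuousAt.continuousWithinAt)
      (fun x hx => (hder (ha.trans (interior_subset hx).1)).hasDerivWithinAt) fun x hx => ?_
    have hax : a ≤ x := (interior_subset hx).1
    have hx0 : 0 < x := by linarith
    have hl6 : 6 ≤ Real.log x := by
      have h := Real.log_le_log (x := 2 ^ 9) (y := x) (by norm_num) (by norm_num; linarith)
      rw [Real.log_pow] at h
      have := Real.log_two_gt_d9
      push_cast at h
      linarith
    set l := Real.log x
    have hl0 : 0 < l := by linarith
    have heq : c * ((1 * l ^ 2 - x * (2 * l ^ 1 * x⁻¹)) / (l ^ 2) ^ 2 +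
        (4 * 1 * l ^ 3 - 4 * x * (3 * l ^ 2 * x⁻¹)) / (l ^ 3) ^ 2) -
        (0 * l - d * x⁻¹) / l ^ 2 + (0 * l - (c * a + d) * x⁻¹) / l ^ 2 =
        c * ((1 - a / x) / l ^ 2 + 2 * (l - 6) / l ^ 4) := by
      field_simp
      ring
    rw [heq]
    have h1 : 0 ≤ 1 - a / x := by
      rw [sub_nonneg, div_le_one hx0]
      exact hax
    have h2 : 0 ≤ l - 6 := by linarith
    positivity
  exact hmono (Set.left_mem_Icc.2 hab) (Set.right_mem_Icc.2 hab) hab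

theorem primeCounting_sub_le {n : ℕ} (hn : 512 ≤ n) :
    (Nat.primeCounting n : ℝ) - Real.log (primorial n) / Real.log n ≤
      1.22 * logTail n - 500 / Real.log n + 178 := by
  induction n, hn using Nat.le_induction with
  | base =>
    have h1 : (Nat.primeCounting 512 : ℝ) ≤ 97 := by
      have h := primeCounting'_add_le_sieveCount 2 511
      rw [show sieveCount 2 511 = 97 by decide +kernel,
        Nat.primeCounting'_eq_zero_iff.2 le_rfl] at h
      exact_mod_cast h
    have h2 : (6 : ℝ) < Real.log (512 : ℕ) := by
      rw [show ((512 : ℕ) : ℝ) = 2 ^ 9 by norm_num, Real.log_pow]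
      have := Real.log_two_gt_d9
      push_cast
      linarith
    have h3 : 0 ≤ Real.log (primorial 512) / Real.log (512 : ℕ) :=
      div_nonneg (Real.log_natCast_nonneg _) (by linarith)
    have h4 : 0 ≤ logTail (512 : ℕ) := by
      unfold logTail
      positivity
    have h5 : 500 / Real.log (512 : ℕ) ≤ 81 := by
      have := Real.log_two_gt_d9
      rw [show ((512 : ℕ) : ℝ) = 2 ^ 9 by norm_num, Real.log_pow, div_le_iff₀ (by positivity)]
      push_cast
      linarith
    generalize Real.log (512 : ℕ) = L at *
    generalize logTail (512 : ℕ) = T at *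
    linarith
  | succ n hn ih =>
    have hn' : (512 : ℝ) ≤ n := by exact_mod_cast hn
    have hstep := logTail_add_div_log_le (c := 1.22) (d := 500) (b := (n + 1 : ℕ))
      (by norm_num) hn' (by push_cast; linarith)
    have hl : 0 < Real.log n := Real.log_pos (by linarith)
    have hl' : 0 < Real.log (n + 1 : ℕ) := Real.log_pos (by push_cast; linarith)
    have hll : Real.log n ≤ Real.log (n + 1 : ℕ) :=
      Real.log_le_log (by linarith) (by push_cast; linarith)
    have hT := log_primorial_le_linear n
    have hinv : 0 ≤ (Real.log n)⁻¹ - (Real.log (n + 1 : ℕ))⁻¹ :=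
      sub_nonneg.2 (inv_anti₀ hl hll)
    have hmul := mul_le_mul_of_nonneg_right hT hinv
    have hpi : (Nat.primeCounting (n + 1) : ℝ) -
        Real.log (primorial (n + 1)) / Real.log (n + 1 : ℕ) =
        Nat.primeCounting n - Real.log (primorial n) / Real.log (n + 1 : ℕ) := by
      have hcount : Nat.primeCounting (n + 1) =
          Nat.primeCounting n + if (n + 1).Prime then 1 else 0 := Nat.count_succ _ _
      rw [hcount, primorial_add n 1, Nat.Ico_succ_singleton, Finset.filter_singleton]
      split_ifs with hp
      · rw [Finset.prod_singleton, Nat.cast_mul, Real.log_mul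
          (by exact_mod_cast primorial_ne_zero n) (by positivity)]
        field_simp
        push_cast
        ring
      · simp
    rw [hpi]
    simp only [div_eq_mul_inv] at *
    linarith

theorem primeCounting_le_of_le {n : ℕ} (hn : 131072 ≤ n) :
    (Nat.primeCounting n : ℝ) * Real.log n ≤ 1.3842 * n := by
  have h := primeCounting_sub_le (n := n) (by omega)
  have hT := log_primorial_le_linear n
  have hn' : (2 : ℝ) ^ 17 ≤ n := by
    norm_num
    exact_mod_cast hn
  have hn0 : (0 : ℝ) < n := by linarith [show (0 : ℝ) < 2 ^ 17 by norm_num]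
  have hl2 := Real.log_two_gt_d9
  have hl2' := Real.log_two_lt_d9
  set l := Real.log n with hl
  have hL : 11.783 ≤ l := by
    have := Real.log_le_log (by norm_num) hn'
    rw [Real.log_pow] at this
    push_cast at this
    linarith
  have hl0 : 0 < l := by linarith
  have hratio : l ≤ n / 11000 := by
    have h1 := Real.log_le_sub_one_of_pos (x := n / 2 ^ 17) (by positivity)
    rw [Real.log_div hn0.ne' (by norm_num), Real.log_pow] at h1
    push_cast at h1
    norm_num at h1 hn'
    linarith
  have htail : logTail n * l = n * (1 / l + 4 / l ^ 2) := by
    unfold logTail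
    rw [← hl]
    field_simp
  have hsmall : 1 / l + 4 / l ^ 2 ≤ 0.1138 := by
    have h1 : 1 / l ≤ 1 / 11.783 := one_div_le_one_div_of_le (by norm_num) hL
    have h2 : 4 / l ^ 2 ≤ 4 / 11.783 ^ 2 := by gcongr
    norm_num at h1 h2 ⊢
    linarith
  have hmul := mul_le_mul_of_nonneg_right h hl0.le
  have e1 : (Nat.primeCounting n - Real.log (primorial n) / l) * l =
      Nat.primeCounting n * l - Real.log (primorial n) := by field_simp
  have e2 : (1.22 * logTail n - 500 / l + 178) * l =
      1.22 * (logTail n * l) - 500 + 178 * l := by field_simp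
  rw [e1, e2, htail] at hmul
  have := mul_le_mul_of_nonneg_left hsmall hn0.le
  linarith

theorem primeCounting_mul_logb_le {n M : ℕ} (h2 : 2 ≤ n) (hM : n < M * M) :
    (Nat.primeCounting n : ℝ) * (2 * M + 1) * Real.logb 2 n ≤ 4 * M * n := by
  rcases lt_or_ge n 131072 with hn | hn
  · exact primeCounting_mul_logb_le_of_lt h2 hn hM
  · have h := primeCounting_le_of_le hn
    have hM' : (362 : ℝ) ≤ M := by
      have : 362 ≤ M := by nlinarith
      exact_mod_cast this
    have hl2 := Real.log_two_gt_d9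
    have hn0 : (0 : ℝ) ≤ n := Nat.cast_nonneg n
    rw [Real.logb, mul_div_assoc', div_le_iff₀ (by linarith)]
    calc (Nat.primeCounting n : ℝ) * (2 * M + 1) * Real.log n
        = (2 * M + 1) * (Nat.primeCounting n * Real.log n) := by ring
      _ ≤ (2 * M + 1) * (1.3842 * n) := by gcongr
      _ = (1.3842 * (2 * M + 1)) * n := by ring
      _ ≤ (4 * M * 0.6931471803) * n := by
        refine mul_le_mul_of_nonneg_right ?_ hn0
        linarith
      _ = 4 * M * n * 0.6931471803 := by ring
      _ ≤ 4 * M * n * Real.log 2 := by gcongr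

/-- If `a ≤ c s log 2`, the function `c t - a log₂ t` is nondecreasing on `[s, ∞)`. -/
theorem mul_logb_le_of_le {a c s t : ℝ} (hs : 0 < s) (hst : s ≤ t) (ha : 0 ≤ a)
    (h : a * Real.logb 2 s ≤ c * s) (has : a ≤ c * s * Real.log 2) :
    a * Real.logb 2 t ≤ c * t := by
  have hl2 : 0 < Real.log 2 := Real.log_pos (by norm_num)
  have hlog : Real.log t ≤ Real.log s + (t / s - 1) := by
    have h1 := Real.log_le_sub_one_of_pos (x := t / s) (by have := hs.trans_le hst; positivity)
    rw [Real.log_div (by linarith) (by linarith)] at h1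
    linarith
  have hdiff : a * (t / s - 1) ≤ c * s * Real.log 2 * (t / s - 1) := by
    gcongr
    rw [sub_nonneg, one_le_div hs]
    exact hst
  have hexp : c * s * Real.log 2 * (t / s - 1) = c * (t - s) * Real.log 2 := by field_simp
  rw [Real.logb, mul_div_assoc', div_le_iff₀ hl2] at h ⊢
  have := mul_le_mul_of_nonneg_left hlog ha
  linarith

theorem primeCounting_mul_logb_le_of_real {n M : ℕ} {x : ℝ} (hnx : (n : ℝ) < x)
    (hxn : x ≤ n + 1) (h1x : 1 < x) (hM : x < M * M) :
    (Nat.primeCounting n : ℝ) * (2 * M + 1) * Real.logb 2 x ≤ 4 * M * x := by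
  have hM0 : (0 : ℝ) ≤ M := Nat.cast_nonneg M
  have hl2 := Real.log_two_gt_d9
  rcases lt_or_ge n 2 with hn | hn
  · rw [Nat.primeCounting_eq_zero_iff.2 (by omega)]
    simp only [Nat.cast_zero, zero_mul]
    positivity
  · have hnM : n < M * M := by exact_mod_cast hnx.trans hM
    have hn' : (2 : ℝ) ≤ n := by exact_mod_cast hn
    have h := primeCounting_mul_logb_le hn hnM
    refine mul_logb_le_of_le (by linarith) hnx.le (by positivity) h ?_
    have hM1 : (1 : ℝ) ≤ M := by
      have : 1 ≤ M := by
        by_contra! h0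
        obtain rfl : M = 0 := by omega
        norm_num at hM
        linarith
      exact_mod_cast this
    rcases hn.eq_or_lt with rfl | hn3
    · have h2 : (Nat.primeCounting 2 : ℝ) = 1 := by exact_mod_cast (by decide)
      rw [h2]
      push_cast
      nlinarith
    · have hlog : 1 ≤ Real.log n := by
        rw [Real.le_log_iff_exp_le (by linarith)]
        have : (3 : ℝ) ≤ n := by exact_mod_cast hn3
        linarith [Real.exp_one_lt_d9]
      rw [Real.logb, mul_div_assoc', div_le_iff₀ (by linarith)] at h
      exact (le_mul_of_one_le_right (by positivity) hlog).trans h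

theorem sum_sieve_le {m x : ℝ} {n : ℕ} (hm : 0 ≤ m) (hnx : (n : ℝ) < x) :
    ∑ p ∈ Nat.primesLE n, ((⌊2 * m * Real.log x / Real.log p⌋₊ + 1 : ℕ) : ℝ) * Real.logb 2 p ≤
      Nat.primeCounting n * (2 * m + 1) * Real.logb 2 x := by
  rw [mul_assoc (Nat.primeCounting n : ℝ), ← Nat.primesLE_card_eq_primeCounting, ← nsmul_eq_mul]
  refine Finset.sum_le_card_nsmul (Nat.primesLE n) _ ((2 * m + 1) * Real.logb 2 x)
    fun p hp => ?_
  rw [Nat.mem_primesLE] at hp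
  have hp1 : (1 : ℝ) < p := by exact_mod_cast hp.2.one_lt
  have hpx : (p : ℝ) ≤ x := (Nat.cast_le.2 hp.1).trans hnx.le
  have hlp : 0 < Real.log p := Real.log_pos hp1
  have hlx : 0 ≤ Real.log x := Real.log_nonneg (hp1.le.trans hpx)
  have hfloor := Nat.floor_le (a := 2 * m * Real.log x / Real.log p) (by positivity)
  have hlogb : 0 ≤ Real.logb 2 p := Real.logb_nonneg (by norm_num) hp1.le
  have hlogb' : Real.logb 2 p ≤ Real.logb 2 x :=
    Real.logb_le_logb_of_le (by norm_num) (by linarith) hpx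
  calc ((⌊2 * m * Real.log x / Real.log p⌋₊ + 1 : ℕ) : ℝ) * Real.logb 2 p
      ≤ (2 * m * Real.log x / Real.log p + 1) * Real.logb 2 p := by
        push_cast
        gcongr
    _ = 2 * m * Real.logb 2 x + Real.logb 2 p := by
        unfold Real.logb
        field_simp
    _ ≤ (2 * m + 1) * Real.logb 2 x := by linarith

open Classical in
/-- For `μ ≥ 2` and `ε ∈ (0,1)`, summing `log₂ p` over all pairs `(p, r)` with
`p` prime, `p < μ^{1+ε}`, and `0 ≤ r ≤ 2(1+ε)·μ·ln(μ)/ln(p)` gives at most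
`4·μ^{2+ε}`. -/
theorem stmt16 (μn : ℕ) (hμ : 2 ≤ μn) (ε : ℝ) (hε : ε ∈ Set.Ioo (0 : ℝ) 1) :
    ∑ p ∈ (Finset.range (Nat.ceil ((μn : ℝ) ^ (1 + ε)))).filter
        (fun p : ℕ => p.Prime ∧ (p : ℝ) < (μn : ℝ) ^ (1 + ε)),
      ((⌊2 * (1 + ε) * (μn : ℝ) * Real.log μn / Real.log p⌋₊ + 1 : ℕ) : ℝ)
          * Real.logb 2 p
      ≤ 4 * (μn : ℝ) ^ (2 + ε) := by
  obtain ⟨hε0, hε1⟩ := hε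
  have hμ1 : (1 : ℝ) < μn := by exact_mod_cast hμ
  have hμ0 : (0 : ℝ) < μn := by linarith
  set x : ℝ := (μn : ℝ) ^ (1 + ε) with hx
  have h1x : 1 < x := Real.one_lt_rpow hμ1 (by linarith)
  have hlog : Real.log x = (1 + ε) * Real.log μn := Real.log_rpow hμ0 _
  have hxM : x < μn * μn := by
    rw [← pow_two, ← Real.rpow_natCast]
    exact Real.rpow_lt_rpow_of_exponent_lt hμ1 (by push_cast; linarith)
  have hpow : (μn : ℝ) ^ (2 + ε) = μn * x := by
    rw [show 2 + ε = 1 + (1 + ε) by ring, Real.rpow_add hμ0, Real.rpow_one]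
  obtain ⟨n, hn⟩ : ∃ n, ⌈x⌉₊ = n + 1 :=
    Nat.exists_eq_add_one.2 (Nat.ceil_pos.2 (by linarith))
  have hnx : (n : ℝ) < x := Nat.lt_ceil.1 (by omega)
  have hxn : x ≤ n + 1 := by exact_mod_cast hn ▸ Nat.le_ceil x
  have hset : (Finset.range ⌈x⌉₊).filter (fun p : ℕ => p.Prime ∧ (p : ℝ) < x) =
      Nat.primesLE n := by
    ext p
    rw [hn, Finset.mem_filter, Finset.mem_range, Nat.mem_primesLE, Nat.lt_succ_iff]
    refine ⟨fun h => ⟨h.1, h.2.1⟩, fun h => ⟨h.1, h.2, ?_⟩⟩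
    exact (Nat.cast_le.2 h.1).trans_lt hnx
  have harg : 2 * (1 + ε) * (μn : ℝ) * Real.log μn = 2 * μn * Real.log x := by
    rw [hlog]
    ring
  rw [hset, harg, hpow, ← mul_assoc]
  exact (sum_sieve_le hμ0.le hnx).trans (primeCounting_mul_logb_le_of_real hnx hxn h1x hxM)
end
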